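/- Let p : ℕ → ℝ with 0 ≤ p(n) ≤ 1, and suppose p(n)·n → ∞ and (1 - p(n))·n² → ∞ as n → ∞. For each n let X : G(n,p(n)) → ℤ be the random variable counting ordered 4-tuples of distinct vertices (v₁, v₂, w₁, w₂) forming an empty square with diagonal pairs {v₁,v₂}, {w₁,w₂}. Then the ratio E(X²)/(E X)² tends to 1 as n → ∞. -/

import Mathlib

open Finset Filter Topology

attribute [local instance] Classical.propDecidable

/-- The Erdős–Rényi weight of a graph `Γ` on `n` vertices with edge probability `p`:
`p^{E_Γ} (1-p)^{C(n,2) - E_Γ}`. -/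
noncomputable def gnpWeight (n : ℕ) (p : ℝ) (Γ : SimpleGraph (Fin n)) : ℝ :=
  p ^ Γ.edgeSet.ncard * (1 - p) ^ (n.choose 2 - Γ.edgeSet.ncard)

/-- The probability of the event `A` under the Erdős–Rényi model `G(n,p)`. -/
noncomputable def gnpProb (n : ℕ) (p : ℝ) (A : SimpleGraph (Fin n) → Prop) : ℝ :=
  ∑ Γ : SimpleGraph (Fin n), if A Γ then gnpWeight n p Γ else 0

/-- The expectation of a random variable `X` under the Erdős–Rényi model `G(n,p)`. -/
noncomputable def gnpExp (n : ℕ) (p : ℝ) (X : SimpleGraph (Fin n) → ℝ) : ℝ :=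
  ∑ Γ : SimpleGraph (Fin n), gnpWeight n p Γ * X Γ

/-- The ordered 4-tuple of distinct vertices `(v₁, v₂, w₁, w₂)` forms an empty square in `Γ`
with diagonal pairs `{v₁,v₂}` and `{w₁,w₂}`: the four sides are edges, the diagonals are not. -/
def IsEmptySquare {V : Type*} (Γ : SimpleGraph V) (v₁ v₂ w₁ w₂ : V) : Prop :=
  v₁ ≠ v₂ ∧ v₁ ≠ w₁ ∧ v₁ ≠ w₂ ∧ v₂ ≠ w₁ ∧ v₂ ≠ w₂ ∧ w₁ ≠ w₂ ∧
    Γ.Adj v₁ w₁ ∧ Γ.Adj v₁ w₂ ∧ Γ.Adj v₂ w₁ ∧ Γ.Adj v₂ w₂ ∧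
    ¬ Γ.Adj v₁ v₂ ∧ ¬ Γ.Adj w₁ w₂

/-- The number of ordered 4-tuples of distinct vertices forming an empty square
(with the first two and last two entries as the diagonal pairs). -/
noncomputable def squareCount (n : ℕ) (Γ : SimpleGraph (Fin n)) : ℤ :=
  ((Finset.univ : Finset (Fin n × Fin n × Fin n × Fin n)).filter
    (fun q => IsEmptySquare Γ q.1 q.2.1 q.2.2.1 q.2.2.2)).card

/-- The sides of the model square on `Fin 4` with diagonals `{0, 1}` and `{2, 3}`. -/
def squareSides : Finset (Sym2 (Fin 4)) := {s(0, 2), s(0, 3), s(1, 2), s(1, 3)}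

/-- The diagonals of the model square on `Fin 4`. -/
def squareDiags : Finset (Sym2 (Fin 4)) := {s(0, 1), s(2, 3)}

/-- The number of members of `A` that are contained in `I`. -/
def inducedCount (A : Finset (Sym2 (Fin 4))) (I : Finset (Fin 4)) : ℕ :=
  (A.filter (fun e => e ∈ I.sym2)).card

lemma disjoint_squareSides_squareDiags : Disjoint squareSides squareDiags := by decide

lemma not_isDiag_of_mem_squareSides : ∀ e ∈ squareSides, ¬ e.IsDiag := by decide

lemma not_isDiag_of_mem_squareDiags : ∀ e ∈ squareDiags, ¬ e.IsDiag := by decide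

lemma inducedCount_eq_zero (I : Finset (Fin 4)) (hI : I.card ≤ 1) :
    inducedCount squareSides I = 0 ∧ inducedCount squareDiags I = 0 := by
  revert I; decide

lemma inducedCount_cases (I : Finset (Fin 4)) (hI : ¬ I.card ≤ 1) :
    (I.card = 2 ∧ inducedCount squareSides I = 1 ∧ inducedCount squareDiags I = 0) ∨
    (I.card = 2 ∧ inducedCount squareSides I = 0 ∧ inducedCount squareDiags I = 1) ∨
    (I.card = 3 ∧ inducedCount squareSides I = 2 ∧ inducedCount squareDiags I = 1) ∨
    (I.card = 4 ∧ inducedCount squareSides I = 4 ∧ inducedCount squareDiags I = 2) := by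
  revert I; decide

/-- The image under `T` of a set of pairs of vertices of the model square. -/
noncomputable def pairImage {n : ℕ} (A : Finset (Sym2 (Fin 4))) (T : Fin 4 → Fin n) :
    Finset (Sym2 (Fin n)) :=
  A.image (Sym2.map T)

/-- The indices `i` for which `T i` lies in the range of `S`. -/
noncomputable def commonIndices {n : ℕ} (S T : Fin 4 → Fin n) : Finset (Fin 4) :=
  Finset.univ.filter (fun i => ∃ j, S j = T i)

/-- The indicator of the event that all pairs in `E` are edges and no pair in `F` is an edge. -/
noncomputable def patternIndicator {n : ℕ} (E F : Finset (Sym2 (Fin n)))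
    (Γ : SimpleGraph (Fin n)) : ℝ :=
  if (∀ e ∈ E, e ∈ Γ.edgeSet) ∧ ∀ e ∈ F, e ∉ Γ.edgeSet then 1 else 0

lemma card_pairImage {n : ℕ} (A : Finset (Sym2 (Fin 4))) {T : Fin 4 → Fin n}
    (hT : Function.Injective T) : (pairImage A T).card = A.card :=
  Finset.card_image_of_injective _ (Sym2.map.injective hT)

lemma card_inter_pairImage_le {n : ℕ} (A : Finset (Sym2 (Fin 4))) (S T : Fin 4 → Fin n) :
    (pairImage A S ∩ pairImage A T).card ≤ inducedCount A (commonIndices S T) := by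
  rw [inducedCount]
  refine le_trans (Finset.card_le_card ?_) (Finset.card_image_le (f := Sym2.map T))
  intro e he
  simp only [pairImage, Finset.mem_inter, Finset.mem_image] at he
  obtain ⟨⟨a, -, rfl⟩, b, hb, hab⟩ := he
  refine Finset.mem_image.2 ⟨b, ?_, hab⟩
  simp only [Finset.mem_filter, Finset.mem_sym2_iff, commonIndices, Finset.mem_univ, true_and]
  refine ⟨hb, fun i hi => ?_⟩
  have : T i ∈ Sym2.map S a := hab ▸ Sym2.mem_map.2 ⟨i, hi, rfl⟩
  obtain ⟨j, -, hj⟩ := Sym2.mem_map.1 this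
  exact ⟨j, hj⟩

lemma not_isDiag_of_mem_pairImage {n : ℕ} {A : Finset (Sym2 (Fin 4))}
    (hA : ∀ e ∈ A, ¬ e.IsDiag) {T : Fin 4 → Fin n} (hT : Function.Injective T) :
    ∀ e ∈ pairImage A T, ¬ e.IsDiag := by
  intro e he
  obtain ⟨a, ha, rfl⟩ := Finset.mem_image.1 he
  rw [Sym2.isDiag_map hT]
  exact hA a ha

lemma sum_simpleGraph_eq_sum_powerset {n : ℕ} (f : Set (Sym2 (Fin n)) → ℝ) :
    ∑ Γ : SimpleGraph (Fin n), f Γ.edgeSet =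
      ∑ t ∈ (Finset.univ.filter (fun e : Sym2 (Fin n) => ¬ e.IsDiag)).powerset, f ↑t := by
  have key (t : Finset (Sym2 (Fin n)))
      (ht : t ∈ (Finset.univ.filter (fun e : Sym2 (Fin n) => ¬ e.IsDiag)).powerset) :
      (SimpleGraph.fromEdgeSet (t : Set (Sym2 (Fin n)))).edgeSet = ↑t := by
    rw [SimpleGraph.edgeSet_fromEdgeSet]
    ext e
    simp only [Set.mem_sdiff, Finset.mem_coe, and_iff_left_iff_imp]
    intro he
    simpa using Finset.mem_powerset.1 ht he
  refine Finset.sum_bij' (fun Γ _ => Γ.edgeFinset)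
    (fun t _ => SimpleGraph.fromEdgeSet (t : Set (Sym2 (Fin n)))) ?_ ?_ ?_ ?_ ?_
  · intro Γ _
    rw [Finset.mem_powerset]
    intro e he
    simpa using Γ.not_isDiag_of_mem_edgeFinset he
  · intro t _
    exact Finset.mem_univ _
  · intro Γ _
    simp
  · intro t ht
    rw [← Finset.coe_inj, SimpleGraph.coe_edgeFinset, key t ht]
  · intro Γ _
    simp

lemma gnpExp_patternIndicator_eq_prod (n : ℕ) (p : ℝ) (E F : Finset (Sym2 (Fin n)))
    (hE : ∀ e ∈ E, ¬ e.IsDiag) :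
    gnpExp n p (patternIndicator E F) =
      ∏ e ∈ Finset.univ.filter (fun e : Sym2 (Fin n) => ¬ e.IsDiag),
        ((if e ∈ F then 0 else p) + (if e ∈ E then 0 else 1 - p)) := by
  have hcard : (Finset.univ.filter (fun e : Sym2 (Fin n) => ¬ e.IsDiag)).card = n.choose 2 := by
    have := Sym2.card_subtype_not_diag (α := Fin n)
    rw [Fintype.card_fin, Fintype.card_subtype] at this
    convert this
  have h := sum_simpleGraph_eq_sum_powerset (n := n) (fun s =>
    p ^ s.ncard * (1 - p) ^ (n.choose 2 - s.ncard) *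
      if (∀ e ∈ E, e ∈ s) ∧ ∀ e ∈ F, e ∉ s then 1 else 0)
  rw [gnpExp]
  refine (Finset.sum_congr rfl fun Γ _ => ?_).trans (h.trans ?_)
  · simp only [gnpWeight, patternIndicator]
    congr
  rw [Finset.prod_add]
  refine Finset.sum_congr rfl fun t ht => ?_
  rw [Finset.mem_powerset] at ht
  rw [Set.ncard_coe_finset, ← hcard, ← Finset.card_sdiff_of_subset ht]
  have hprodF : ∏ e ∈ t, (if e ∈ F then 0 else p) = if ∀ e ∈ F, e ∉ t then p ^ t.card else 0 := by
    split_ifs with hc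
    · rw [← Finset.prod_const]
      exact Finset.prod_congr rfl fun e he => if_neg fun heF => hc e heF he
    · push Not at hc
      obtain ⟨e, heF, het⟩ := hc
      exact Finset.prod_eq_zero het (if_pos heF)
  have hprodE : ∏ e ∈ Finset.univ.filter (fun e : Sym2 (Fin n) => ¬ e.IsDiag) \ t,
      (if e ∈ E then 0 else 1 - p) = if ∀ e ∈ E, e ∈ t then
        (1 - p) ^ (Finset.univ.filter (fun e : Sym2 (Fin n) => ¬ e.IsDiag) \ t).card else 0 := by
    split_ifs with hc
    · rw [← Finset.prod_const]
      exact Finset.prod_congr rfl fun e he =>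
        if_neg fun heE => (Finset.mem_sdiff.1 he).2 (hc e heE)
    · push Not at hc
      obtain ⟨e, heE, het⟩ := hc
      refine Finset.prod_eq_zero (i := e) ?_ (if_pos heE)
      simp [het, hE e heE]
  rw [hprodF, hprodE]
  simp only [Finset.mem_coe]
  split_ifs <;> first | ring1 | tauto

lemma gnpExp_patternIndicator (n : ℕ) (p : ℝ) (E F : Finset (Sym2 (Fin n)))
    (hE : ∀ e ∈ E, ¬ e.IsDiag) (hF : ∀ e ∈ F, ¬ e.IsDiag) (hEF : Disjoint E F) :
    gnpExp n p (patternIndicator E F) = p ^ E.card * (1 - p) ^ F.card := by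
  rw [gnpExp_patternIndicator_eq_prod n p E F hE]
  have hsplit (e : Sym2 (Fin n)) : (if e ∈ F then 0 else p) + (if e ∈ E then 0 else 1 - p) =
      (if e ∈ E then p else 1) * (if e ∈ F then 1 - p else 1) := by
    have : e ∈ E → e ∉ F := fun h => Finset.disjoint_left.1 hEF h
    by_cases h1 : e ∈ E <;> by_cases h2 : e ∈ F <;> simp_all
  simp_rw [hsplit]
  rw [Finset.prod_mul_distrib, ← Finset.prod_filter, ← Finset.prod_filter, Finset.prod_const,
    Finset.prod_const]
  congr 3 <;> ext e <;> simp <;> grind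

lemma gnpExp_patternIndicator_of_not_disjoint (n : ℕ) (p : ℝ) (E F : Finset (Sym2 (Fin n)))
    (hEF : ¬ Disjoint E F) : gnpExp n p (patternIndicator E F) = 0 := by
  obtain ⟨e, heE, heF⟩ := Finset.not_disjoint_iff.1 hEF
  refine Finset.sum_eq_zero fun Γ _ => ?_
  rw [patternIndicator, if_neg fun h => h.2 e heF (h.1 e heE), mul_zero]

lemma gnpExp_patternIndicator_le (n : ℕ) {p : ℝ} (hp0 : 0 ≤ p) (hp1 : p ≤ 1)
    (E F : Finset (Sym2 (Fin n))) (hE : ∀ e ∈ E, ¬ e.IsDiag) (hF : ∀ e ∈ F, ¬ e.IsDiag) :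
    gnpExp n p (patternIndicator E F) ≤ p ^ E.card * (1 - p) ^ F.card := by
  by_cases hEF : Disjoint E F
  · exact (gnpExp_patternIndicator n p E F hE hF hEF).le
  · rw [gnpExp_patternIndicator_of_not_disjoint n p E F hEF]
    have : 0 ≤ 1 - p := sub_nonneg.2 hp1
    positivity

lemma sum_gnpWeight (n : ℕ) (p : ℝ) : ∑ Γ : SimpleGraph (Fin n), gnpWeight n p Γ = 1 := by
  have := gnpExp_patternIndicator n p ∅ ∅ (by simp) (by simp) (by simp)
  simpa [gnpExp, patternIndicator] using this

lemma gnpWeight_nonneg (n : ℕ) {p : ℝ} (hp0 : 0 ≤ p) (hp1 : p ≤ 1) (Γ : SimpleGraph (Fin n)) :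
    0 ≤ gnpWeight n p Γ :=
  mul_nonneg (pow_nonneg hp0 _) (pow_nonneg (sub_nonneg.2 hp1) _)

lemma gnpExp_sq_le (n : ℕ) {p : ℝ} (hp0 : 0 ≤ p) (hp1 : p ≤ 1) (X : SimpleGraph (Fin n) → ℝ) :
    gnpExp n p X ^ 2 ≤ gnpExp n p (fun Γ => X Γ ^ 2) := by
  have h : 0 ≤ ∑ Γ, gnpWeight n p Γ * (X Γ - gnpExp n p X) ^ 2 :=
    Finset.sum_nonneg fun Γ _ => mul_nonneg (gnpWeight_nonneg n hp0 hp1 Γ) (sq_nonneg _)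
  have hexpand (m : ℝ) : ∑ Γ, gnpWeight n p Γ * (X Γ - m) ^ 2 =
      gnpExp n p (fun Γ => X Γ ^ 2) - 2 * m * gnpExp n p X +
        m ^ 2 * ∑ Γ, gnpWeight n p Γ := by
    rw [gnpExp, gnpExp, Finset.mul_sum, Finset.mul_sum, ← Finset.sum_sub_distrib,
      ← Finset.sum_add_distrib]
    exact Finset.sum_congr rfl fun Γ _ => by ring
  rw [hexpand, sum_gnpWeight] at h
  linarith

lemma gnpExp_sum {ι : Type*} (n : ℕ) (p : ℝ) (s : Finset ι) (X : ι → SimpleGraph (Fin n) → ℝ) :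
    gnpExp n p (fun Γ => ∑ i ∈ s, X i Γ) = ∑ i ∈ s, gnpExp n p (X i) := by
  simp_rw [gnpExp, Finset.mul_sum]
  exact Finset.sum_comm

/-- The injective labellings of four vertices of `Fin n`. -/
noncomputable def injectiveQuadruples (n : ℕ) : Finset (Fin 4 → Fin n) :=
  Finset.univ.filter Function.Injective

lemma card_injectiveQuadruples (n : ℕ) : (injectiveQuadruples n).card = n.descFactorial 4 := by
  have h := Fintype.card_embedding_eq (α := Fin 4) (β := Fin n)
  rw [Fintype.card_fin, Fintype.card_fin, ← Fintype.card_congr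
    (Equiv.subtypeInjectiveEquivEmbedding (Fin 4) (Fin n)), Fintype.card_subtype] at h
  convert h using 2
  ext
  simp [injectiveQuadruples]

/-- The indicator that `T` labels an empty square. -/
noncomputable def squareIndicator {n : ℕ} (T : Fin 4 → Fin n) : SimpleGraph (Fin n) → ℝ :=
  patternIndicator (pairImage squareSides T) (pairImage squareDiags T)

lemma isEmptySquare_iff {n : ℕ} (Γ : SimpleGraph (Fin n)) (T : Fin 4 → Fin n) :
    IsEmptySquare Γ (T 0) (T 1) (T 2) (T 3) ↔ Function.Injective T ∧
      (∀ e ∈ pairImage squareSides T, e ∈ Γ.edgeSet) ∧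
        ∀ e ∈ pairImage squareDiags T, e ∉ Γ.edgeSet := by
  have hinj : Function.Injective T ↔ T 0 ≠ T 1 ∧ T 0 ≠ T 2 ∧ T 0 ≠ T 3 ∧ T 1 ≠ T 2 ∧
      T 1 ≠ T 3 ∧ T 2 ≠ T 3 := by
    constructor
    · intro h
      refine ⟨?_, ?_, ?_, ?_, ?_, ?_⟩ <;> exact h.ne (by simp)
    · rintro ⟨h1, h2, h3, h4, h5, h6⟩ i j hij
      fin_cases i <;> fin_cases j <;> simp_all [eq_comm]
  rw [hinj]
  simp only [IsEmptySquare, pairImage, squareSides, squareDiags, Finset.forall_mem_image,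
    Finset.mem_insert, Finset.mem_singleton, forall_eq_or_imp, forall_eq, Sym2.map_mk,
    SimpleGraph.mem_edgeSet]
  tauto

lemma squareCount_eq_sum (n : ℕ) (Γ : SimpleGraph (Fin n)) :
    (squareCount n Γ : ℝ) = ∑ T ∈ injectiveQuadruples n, squareIndicator T Γ := by
  simp only [squareIndicator, patternIndicator]
  rw [Finset.sum_boole, squareCount, Int.cast_natCast, Nat.cast_inj]
  refine Finset.card_bij' (fun q _ => ![q.1, q.2.1, q.2.2.1, q.2.2.2])
    (fun T _ => (T 0, T 1, T 2, T 3)) ?_ ?_ ?_ ?_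
  · intro q hq
    have := (isEmptySquare_iff Γ ![q.1, q.2.1, q.2.2.1, q.2.2.2]).1 (Finset.mem_filter.1 hq).2
    simpa only [injectiveQuadruples, Finset.mem_filter, Finset.mem_univ, true_and] using this
  · intro T hT
    simp only [injectiveQuadruples, Finset.mem_filter, Finset.mem_univ, true_and] at hT ⊢
    exact (isEmptySquare_iff Γ T).2 hT
  · intro q _
    rfl
  · intro T _
    ext i
    fin_cases i <;> rfl

lemma gnpExp_squareCount (n : ℕ) (p : ℝ) :
    gnpExp n p (fun Γ => (squareCount n Γ : ℝ)) =
      (n.descFactorial 4 : ℝ) * (p ^ 4 * (1 - p) ^ 2) := by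
  simp_rw [squareCount_eq_sum]
  rw [gnpExp_sum, ← card_injectiveQuadruples, ← nsmul_eq_mul]
  refine Finset.sum_eq_card_nsmul fun T hT => ?_
  have hT : Function.Injective T := (Finset.mem_filter.1 hT).2
  rw [squareIndicator, gnpExp_patternIndicator, card_pairImage _ hT, card_pairImage _ hT]
  · rfl
  · exact not_isDiag_of_mem_pairImage not_isDiag_of_mem_squareSides hT
  · exact not_isDiag_of_mem_pairImage not_isDiag_of_mem_squareDiags hT
  · exact (Finset.disjoint_image (Sym2.map.injective hT)).2 disjoint_squareSides_squareDiags

lemma patternIndicator_mul {n : ℕ} (E F E₂ F₂ : Finset (Sym2 (Fin n)))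
    (Γ : SimpleGraph (Fin n)) :
    patternIndicator E F Γ * patternIndicator E₂ F₂ Γ = patternIndicator (E ∪ E₂) (F ∪ F₂) Γ := by
  simp only [patternIndicator, Finset.mem_union, or_imp, forall_and, ← ite_and, mul_ite, mul_one,
    mul_zero]
  congr 1
  simp only [eq_iff_iff]
  tauto

lemma gnpExp_squareIndicator_mul_le {n : ℕ} {p : ℝ} (hp0 : 0 ≤ p) (hp1 : p ≤ 1)
    {S T : Fin 4 → Fin n} (hS : Function.Injective S) (hT : Function.Injective T) :
    gnpExp n p (fun Γ => squareIndicator S Γ * squareIndicator T Γ) ≤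
      p ^ (8 - inducedCount squareSides (commonIndices S T)) *
        (1 - p) ^ (4 - inducedCount squareDiags (commonIndices S T)) := by
  have hq0 : 0 ≤ 1 - p := sub_nonneg.2 hp1
  have hq1 : 1 - p ≤ 1 := by linarith
  have hcard (A : Finset (Sym2 (Fin 4))) :
      2 * A.card - inducedCount A (commonIndices S T) ≤ (pairImage A S ∪ pairImage A T).card := by
    have h1 := Finset.card_union_add_card_inter (pairImage A S) (pairImage A T)
    rw [card_pairImage A hS, card_pairImage A hT] at h1
    have h2 := card_inter_pairImage_le A S T
    omega
  simp_rw [squareIndicator, patternIndicator_mul]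
  refine (gnpExp_patternIndicator_le n hp0 hp1 _ _ ?_ ?_).trans ?_
  · intro e he
    rcases Finset.mem_union.1 he with he | he
    · exact not_isDiag_of_mem_pairImage not_isDiag_of_mem_squareSides hS e he
    · exact not_isDiag_of_mem_pairImage not_isDiag_of_mem_squareSides hT e he
  · intro e he
    rcases Finset.mem_union.1 he with he | he
    · exact not_isDiag_of_mem_pairImage not_isDiag_of_mem_squareDiags hS e he
    · exact not_isDiag_of_mem_pairImage not_isDiag_of_mem_squareDiags hT e he
  · exact mul_le_mul (pow_le_pow_of_le_one hp0 hp1 (hcard squareSides))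
      (pow_le_pow_of_le_one hq0 hq1 (hcard squareDiags)) (by positivity) (by positivity)

lemma card_filter_commonIndices_le {n : ℕ} (S : Fin 4 → Fin n) (I : Finset (Fin 4)) :
    (Finset.univ.filter (fun T : Fin 4 → Fin n => commonIndices S T = I)).card ≤
      4 ^ I.card * n ^ (4 - I.card) := by
  have hsub : Finset.univ.filter (fun T : Fin 4 → Fin n => commonIndices S T = I) ⊆
      Fintype.piFinset (fun i => if i ∈ I then Finset.univ.image S else Finset.univ) := by
    intro T hT
    obtain rfl := (Finset.mem_filter.1 hT).2
    rw [Fintype.mem_piFinset]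
    intro i
    split_ifs with hi
    · simpa [commonIndices] using hi
    · exact Finset.mem_univ _
  refine (Finset.card_le_card hsub).trans ?_
  rw [Fintype.card_piFinset]
  calc ∏ i, (if i ∈ I then Finset.univ.image S else Finset.univ).card
      ≤ ∏ i : Fin 4, (if i ∈ I then 4 else n) := by
        refine Finset.prod_le_prod' fun i _ => ?_
        split_ifs
        · simpa using Finset.card_image_le (s := Finset.univ) (f := S)
        · simp
    _ = 4 ^ I.card * n ^ (4 - I.card) := by
        rw [Finset.prod_ite, Finset.prod_const, Finset.prod_const, Finset.filter_not,
          Finset.card_sdiff]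
        simp

lemma gnpExp_squareCount_sq_le (n : ℕ) {p : ℝ} (hp0 : 0 ≤ p) (hp1 : p ≤ 1) :
    gnpExp n p (fun Γ => (squareCount n Γ : ℝ) ^ 2) ≤
      (n.descFactorial 4 : ℝ) ^ 2 * (p ^ 4 * (1 - p) ^ 2) ^ 2 +
        n.descFactorial 4 * ∑ I : Finset (Fin 4) with ¬ I.card ≤ 1,
          ((4 : ℝ) ^ I.card * (n : ℝ) ^ (4 - I.card)) *
            (p ^ (8 - inducedCount squareSides I) * (1 - p) ^ (4 - inducedCount squareDiags I)) := by
  have hq0 : 0 ≤ 1 - p := sub_nonneg.2 hp1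
  set b : Finset (Fin 4) → ℝ := fun I =>
    p ^ (8 - inducedCount squareSides I) * (1 - p) ^ (4 - inducedCount squareDiags I) with hb
  have hb0 (I) : 0 ≤ b I := by positivity
  have hrow (S : Fin 4 → Fin n) : ∑ T ∈ injectiveQuadruples n, b (commonIndices S T) ≤
      n.descFactorial 4 * (p ^ 4 * (1 - p) ^ 2) ^ 2 + ∑ I : Finset (Fin 4) with ¬ I.card ≤ 1,
        ((4 : ℝ) ^ I.card * (n : ℝ) ^ (4 - I.card)) * b I := by
    rw [← Finset.sum_filter_add_sum_filter_not _ (fun T => (commonIndices S T).card ≤ 1)]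
    refine add_le_add ?_ ?_
    · rw [Finset.sum_congr rfl (g := fun _ => (p ^ 4 * (1 - p) ^ 2) ^ 2), Finset.sum_const,
        nsmul_eq_mul, ← card_injectiveQuadruples]
      · have : ((injectiveQuadruples n).filter (fun T => (commonIndices S T).card ≤ 1)).card ≤
          (injectiveQuadruples n).card := Finset.card_filter_le _ _
        gcongr
      · intro T hT
        obtain ⟨h1, h2⟩ := inducedCount_eq_zero _ (Finset.mem_filter.1 hT).2
        simp only [hb, h1, h2]
        ring
    · rw [← Finset.sum_fiberwise_of_maps_to
        (t := Finset.univ.filter (fun I : Finset (Fin 4) => ¬ I.card ≤ 1))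
        (g := commonIndices S) (fun T hT => by simpa using (Finset.mem_filter.1 hT).2)]
      refine Finset.sum_le_sum fun I _ => ?_
      rw [Finset.sum_congr rfl (g := fun _ => b I)
        (fun T hT => by rw [(Finset.mem_filter.1 hT).2]), Finset.sum_const, nsmul_eq_mul]
      refine mul_le_mul_of_nonneg_right ?_ (hb0 I)
      have h := (Finset.card_le_card (Finset.filter_subset_filter
        (fun T : Fin 4 → Fin n => commonIndices S T = I) (Finset.subset_univ
          ((injectiveQuadruples n).filter (fun T => ¬ (commonIndices S T).card ≤ 1))))).trans
          (card_filter_commonIndices_le S I)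
      exact_mod_cast h
  have hexpand : gnpExp n p (fun Γ => (squareCount n Γ : ℝ) ^ 2) =
      ∑ S ∈ injectiveQuadruples n, ∑ T ∈ injectiveQuadruples n,
        gnpExp n p (fun Γ => squareIndicator S Γ * squareIndicator T Γ) := by
    simp_rw [squareCount_eq_sum, sq, Finset.sum_mul_sum, gnpExp_sum]
  rw [hexpand]
  calc _ ≤ ∑ S ∈ injectiveQuadruples n, ∑ T ∈ injectiveQuadruples n, b (commonIndices S T) :=
        Finset.sum_le_sum fun S hS => Finset.sum_le_sum fun T hT =>
          gnpExp_squareIndicator_mul_le hp0 hp1 (Finset.mem_filter.1 hS).2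
            (Finset.mem_filter.1 hT).2
    _ ≤ ∑ S ∈ injectiveQuadruples n, (n.descFactorial 4 * (p ^ 4 * (1 - p) ^ 2) ^ 2 +
          ∑ I : Finset (Fin 4) with ¬ I.card ≤ 1,
            ((4 : ℝ) ^ I.card * (n : ℝ) ^ (4 - I.card)) * b I) :=
        Finset.sum_le_sum fun S _ => hrow S
    _ = _ := by
        rw [Finset.sum_const, card_injectiveQuadruples, nsmul_eq_mul]
        ring

lemma pow_four_le_descFactorial {n : ℕ} (hn : 4 ≤ n) :
    (n : ℝ) ^ 4 ≤ 256 * (n.descFactorial 4 : ℝ) := by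
  have h1 := Nat.pow_sub_le_descFactorial n 4
  have h2 : n ^ 4 ≤ (4 * (n + 1 - 4)) ^ 4 := Nat.pow_le_pow_left (by omega) 4
  rw [mul_pow] at h2
  have : n ^ 4 ≤ 256 * n.descFactorial 4 := h2.trans (by omega)
  exact_mod_cast this

lemma inducedCount_squareSides_le (I : Finset (Fin 4)) : inducedCount squareSides I ≤ 8 :=
  (Finset.card_filter_le _ _).trans (Finset.card_le_four.trans (by norm_num))

lemma inducedCount_squareDiags_le (I : Finset (Fin 4)) : inducedCount squareDiags I ≤ 4 :=
  (Finset.card_filter_le _ _).trans (Finset.card_le_two.trans (by norm_num))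

lemma second_moment_ratio_le {n : ℕ} (hn : 4 ≤ n) {p : ℝ} (hp0 : 0 < p) (hp1 : p < 1) :
    gnpExp n p (fun Γ => (squareCount n Γ : ℝ) ^ 2) /
        gnpExp n p (fun Γ => (squareCount n Γ : ℝ)) ^ 2 ≤
      1 + ∑ I : Finset (Fin 4) with ¬ I.card ≤ 1, (256 * 4 ^ I.card) *
        ((n : ℝ) ^ I.card * p ^ inducedCount squareSides I *
          (1 - p) ^ inducedCount squareDiags I)⁻¹ := by
  have hq : 0 < 1 - p := sub_pos.2 hp1
  have hn0 : (0 : ℝ) < n := by exact_mod_cast (by omega : 0 < n)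
  have hN := pow_four_le_descFactorial hn
  have hN0 : (0 : ℝ) < n.descFactorial 4 := by
    exact_mod_cast Nat.descFactorial_pos.2 hn
  rw [gnpExp_squareCount, div_le_iff₀ (by positivity)]
  refine (gnpExp_squareCount_sq_le n hp0.le hp1.le).trans ?_
  rw [add_mul, one_mul, Finset.sum_mul, Finset.mul_sum]
  refine add_le_add (mul_pow _ _ 2).ge (Finset.sum_le_sum fun I _ => ?_)
  have hI : I.card ≤ 4 := by simpa using Finset.card_le_univ I
  have hpI : p ^ 8 = p ^ (8 - inducedCount squareSides I) * p ^ inducedCount squareSides I :=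
    (pow_sub_mul_pow _ (inducedCount_squareSides_le I)).symm
  have hqI : (1 - p) ^ 4 =
      (1 - p) ^ (4 - inducedCount squareDiags I) * (1 - p) ^ inducedCount squareDiags I :=
    (pow_sub_mul_pow _ (inducedCount_squareDiags_le I)).symm
  have hnI : (n : ℝ) ^ 4 = (n : ℝ) ^ (4 - I.card) * (n : ℝ) ^ I.card :=
    (pow_sub_mul_pow _ hI).symm
  have hsq : ((n.descFactorial 4 : ℝ) * (p ^ 4 * (1 - p) ^ 2)) ^ 2 =
      (n.descFactorial 4 : ℝ) ^ 2 * (p ^ 8 * (1 - p) ^ 4) := by ring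
  rw [hsq, hpI, hqI]
  rw [hnI] at hN
  set N := (n.descFactorial 4 : ℝ)
  set x := (n : ℝ) ^ (4 - I.card)
  have hy : 0 < (n : ℝ) ^ I.card := by positivity
  set y := (n : ℝ) ^ I.card
  have hs : 0 < p ^ inducedCount squareSides I := by positivity
  have ht : 0 < (1 - p) ^ inducedCount squareDiags I := by positivity
  set s := p ^ inducedCount squareSides I
  set t := (1 - p) ^ inducedCount squareDiags I
  have hu : 0 < p ^ (8 - inducedCount squareSides I) := by positivity
  have hv : 0 < (1 - p) ^ (4 - inducedCount squareDiags I) := by positivity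
  set u := p ^ (8 - inducedCount squareSides I)
  set v := (1 - p) ^ (4 - inducedCount squareDiags I)
  have hx : x ≤ 256 * N * y⁻¹ := by rwa [← div_eq_mul_inv, le_div_iff₀ hy]
  calc N * (4 ^ I.card * x * (u * v)) ≤ N * (4 ^ I.card * (256 * N * y⁻¹) * (u * v)) := by
        gcongr
    _ = _ := by
        field_simp

lemma tendsto_threshold (p : ℕ → ℝ) (hp : ∀ n, 0 ≤ p n ∧ p n ≤ 1)
    (h1 : Tendsto (fun n : ℕ => p n * (n : ℝ)) atTop atTop)
    (h2 : Tendsto (fun n : ℕ => (1 - p n) * (n : ℝ) ^ 2) atTop atTop)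
    (I : Finset (Fin 4)) (hI : ¬ I.card ≤ 1) :
    Tendsto (fun n : ℕ => (n : ℝ) ^ I.card * p n ^ inducedCount squareSides I *
      (1 - p n) ^ inducedCount squareDiags I) atTop atTop := by
  have hpath : Tendsto (fun n : ℕ => (n : ℝ) ^ 2 * p n ^ 2 * (1 - p n)) atTop atTop := by
    refine tendsto_atTop.2 fun C => ?_
    filter_upwards [tendsto_atTop.1 h1 (2 * max C 1), tendsto_atTop.1 h2 (4 * max C 1)] with n ha hb
    obtain ⟨hp0, hp1⟩ := hp n
    have hC := le_max_left C 1
    have hC1 := le_max_right C 1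
    generalize max C 1 = D at *
    rcases le_total (p n) (1 / 2) with h | h
    · have hx : D ≤ (p n * n) ^ 2 / 2 := by nlinarith
      nlinarith [mul_nonneg (sq_nonneg (p n * n)) (by linarith : 0 ≤ 1 / 2 - p n)]
    · have hsq : 1 / 4 ≤ p n ^ 2 := by nlinarith
      nlinarith [mul_le_mul_of_nonneg_right hsq (by linarith : 0 ≤ (1 - p n) * (n : ℝ) ^ 2)]
  have hone : ∀ᶠ n : ℕ in atTop, (1 : ℝ) ≤ n := by
    filter_upwards [eventually_ge_atTop 1] with n hn
    exact_mod_cast hn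
  rcases inducedCount_cases I hI with ⟨h, hs, hd⟩ | ⟨h, hs, hd⟩ | ⟨h, hs, hd⟩ | ⟨h, hs, hd⟩ <;>
    rw [h, hs, hd]
  · refine tendsto_atTop_mono' _ ?_ h1
    filter_upwards [hone] with n hn
    have := mul_le_mul_of_nonneg_right hn (mul_nonneg (hp n).1 (Nat.cast_nonneg n))
    linarith
  · exact h2.congr fun n => by ring
  · refine tendsto_atTop_mono' _ ?_ hpath
    filter_upwards [hone] with n hn
    have hq : 0 ≤ 1 - p n := sub_nonneg.2 (hp n).2
    have := mul_le_mul_of_nonneg_right hn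
      (by positivity : 0 ≤ (n : ℝ) ^ 2 * p n ^ 2 * (1 - p n))
    linarith
  · exact ((tendsto_pow_atTop two_ne_zero).comp hpath).congr fun n => by
      simp only [Function.comp_apply]
      ring

/-- Second moment estimate: if `p(n)·n → ∞` and `(1-p(n))·n² → ∞`, then
`E(X²)/(E X)² → 1` for the empty-square count `X`. -/
theorem gnp_squareCount_second_moment (p : ℕ → ℝ) (hp : ∀ n, 0 ≤ p n ∧ p n ≤ 1)
    (h1 : Tendsto (fun n : ℕ => p n * (n : ℝ)) atTop atTop)
    (h2 : Tendsto (fun n : ℕ => (1 - p n) * (n : ℝ) ^ 2) atTop atTop) :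
    Tendsto (fun n : ℕ =>
      gnpExp n (p n) (fun Γ => ((squareCount n Γ : ℝ)) ^ 2) /
        (gnpExp n (p n) (fun Γ => (squareCount n Γ : ℝ))) ^ 2)
      atTop (nhds 1) := by
  have hgood : ∀ᶠ n : ℕ in atTop, 4 ≤ n ∧ 0 < p n ∧ p n < 1 := by
    filter_upwards [eventually_ge_atTop 4, h1.eventually_gt_atTop 0, h2.eventually_gt_atTop 0]
      with n hn ha hb
    exact ⟨hn, pos_of_mul_pos_left ha (Nat.cast_nonneg n),
      sub_pos.1 (pos_of_mul_pos_left hb (by positivity))⟩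
  have hlim : Tendsto (fun n : ℕ => 1 + ∑ I : Finset (Fin 4) with ¬ I.card ≤ 1,
      (256 * 4 ^ I.card) * ((n : ℝ) ^ I.card * p n ^ inducedCount squareSides I *
        (1 - p n) ^ inducedCount squareDiags I)⁻¹) atTop (𝓝 1) := by
    have : Tendsto (fun n : ℕ => ∑ I : Finset (Fin 4) with ¬ I.card ≤ 1,
        (256 * 4 ^ I.card : ℝ) * ((n : ℝ) ^ I.card * p n ^ inducedCount squareSides I *
          (1 - p n) ^ inducedCount squareDiags I)⁻¹) atTop
        (𝓝 (∑ I : Finset (Fin 4) with ¬ I.card ≤ 1, (256 * 4 ^ I.card : ℝ) * 0)) :=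
      tendsto_finsetSum _ fun I hI => (tendsto_inv_atTop_zero.comp
        (tendsto_threshold p hp h1 h2 I (Finset.mem_filter.1 hI).2)).const_mul _
    simpa using this.const_add 1
  refine tendsto_of_tendsto_of_tendsto_of_le_of_le' tendsto_const_nhds hlim ?_ ?_
  · filter_upwards [hgood] with n hn
    obtain ⟨hn, hp0, hp1⟩ := hn
    have hq : 0 < 1 - p n := sub_pos.2 hp1
    have hN0 : (0 : ℝ) < n.descFactorial 4 := by exact_mod_cast Nat.descFactorial_pos.2 hn
    rw [one_le_div (by rw [gnpExp_squareCount]; positivity)]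
    exact gnpExp_sq_le n hp0.le hp1.le _
  · filter_upwards [hgood] with n hn
    exact second_moment_ratio_le hn.1 hn.2.1 hn.2.2
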